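/- Let a ∈ R^n be nonnegative with a_1 > 0, and let b ∈ R be such that the inequality <a, x> ≤ b is valid for the stable set polytope of a graph G on n vertices and is tight at the characteristic vectors of at least two distinct stable sets S1, S2 with S1 containing vertex 1 and S2 not containing vertex 1. If moreover for every edge {u,v} of G the inequality is not a positive multiple of x_u + x_v ≤ 1 and a is supported on all of {1,...,n} with the inequality facet-defining for the stable set polytope, then a_1 ≤ a_1 + ... + a_n − 2b. -/

import Mathlib

def IsStable {V : Type*} (G : SimpleGraph V) (S : Finset V) : Prop :=
  ∀ u ∈ S, ∀ v ∈ S, ¬ G.Adj u v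

noncomputable def chi {V : Type*} [DecidableEq V] (S : Finset V) : V → ℝ :=
  fun v => if v ∈ S then 1 else 0

noncomputable def Pstab {V : Type*} [Fintype V] [DecidableEq V] (G : SimpleGraph V) :
    Set (V → ℝ) :=
  convexHull ℝ {x | ∃ S : Finset V, IsStable G S ∧ x = chi S}

theorem chi_sum {V : Type*} [Fintype V] [DecidableEq V] (c : V → ℝ) (S : Finset V) :
    ∑ v, c v * chi S v = ∑ v ∈ S, c v := by
  simp [chi, Finset.sum_ite_mem]

theorem facet_prop {V : Type*} [Fintype V] [DecidableEq V] (G : SimpleGraph V)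
    (a : V → ℝ) (b : ℝ) (v0 : V) (hav0 : 0 < a v0)
    (hst : ∀ S : Finset V, IsStable G S → ∑ v ∈ S, a v ≤ b)
    (hfacet : Module.finrank ℝ ↥(vectorSpan ℝ {x ∈ Pstab G | ∑ v, a v * x v = b})
      = Fintype.card V - 1)
    (c : V → ℝ)
    (hc : ∀ S : Finset V, IsStable G S → ∑ v ∈ S, a v = b → ∑ v ∈ S, c v = 1) :
    ∀ w z, a w * c z = a z * c w := by
  classical
  let φ : (V → ℝ) → ((V → ℝ) →ₗ[ℝ] ℝ) := fun d => ∑ v, d v • LinearMap.proj v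
  have hφ : ∀ d x, φ d x = ∑ v, d v * x v := by
    intro d x; simp [φ]
  have hface : ∀ x ∈ Pstab G, φ a x < b ∨ (φ a x = b ∧ φ c x = 1) := by
    have : Pstab G ⊆ {x | φ a x < b ∨ (φ a x = b ∧ φ c x = 1)} := by
      apply convexHull_min
      · rintro x ⟨S, hS, rfl⟩
        simp only [Set.mem_ofPred_eq, hφ, chi_sum]
        rcases (hst S hS).lt_or_eq with h | h
        · exact Or.inl h
        · exact Or.inr ⟨h, hc S hS h⟩
      · rw [convex_iff_forall_pos]
        intro x hx y hy s t hs ht hst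
        simp only [Set.mem_ofPred_eq, map_add, map_smul, smul_eq_mul] at *
        have hs' : s = 1 - t := by linarith
        have hb : s * b + t * b = b := by rw [← add_mul, hst, one_mul]
        rcases hx with hx | ⟨hx, hx'⟩ <;> rcases hy with hy | ⟨hy, hy'⟩
        · left; linarith [mul_lt_mul_of_pos_left hx hs, mul_lt_mul_of_pos_left hy ht]
        · left; rw [hy]; linarith [mul_lt_mul_of_pos_left hx hs]
        · left; rw [hx]; linarith [mul_lt_mul_of_pos_left hy ht]
        · right; rw [hx, hy, hx', hy']; exact ⟨hb, by linarith⟩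
    exact this
  set F := {x ∈ Pstab G | ∑ v, a v * x v = b} with hF
  have hFa : ∀ x ∈ F, φ a x = b := fun x hx => by rw [hφ]; exact hx.2
  have hFc : ∀ x ∈ F, φ c x = 1 := fun x hx => by
    rcases hface x hx.1 with h | h
    · exact absurd (hFa x hx) h.ne
    · exact h.2
  have hker : ∀ (d : V → ℝ) (k : ℝ), (∀ x ∈ F, φ d x = k) →
      vectorSpan ℝ F ≤ LinearMap.ker (φ d) := by
    intro d k h
    rw [vectorSpan_def, Submodule.span_le]
    rintro _ ⟨x, hx, y, hy, rfl⟩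
    simp [h x hx, h y hy]
  have hne : φ a ≠ 0 := by
    intro h
    have := congrArg (fun f => f (Pi.single v0 1)) h
    simp [hφ, Pi.single_apply] at this
    exact hav0.ne' this
  have hrk : Module.finrank ℝ (LinearMap.ker (φ a)) = Fintype.card V - 1 := by
    have h1 := LinearMap.finrank_range_add_finrank_ker (φ a)
    have h2 : Module.finrank ℝ (LinearMap.range (φ a)) = 1 := by
      rw [LinearMap.range_eq_top.2 (LinearMap.surjective hne)]; simp
    rw [Module.finrank_fintype_fun_eq_card] at h1
    omega
  have heq := Submodule.eq_of_le_of_finrank_eq (hker a b hFa) (hfacet.trans hrk.symm)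
  have hle := hker c 1 hFc
  rw [heq] at hle
  intro w z
  have hmem : (a w • Pi.single z 1 - a z • Pi.single w 1 : V → ℝ) ∈ LinearMap.ker (φ a) := by
    rw [LinearMap.mem_ker, map_sub, map_smul, map_smul]
    simp [hφ, Pi.single_apply]; ring
  have := hle hmem
  rw [LinearMap.mem_ker, map_sub, map_smul, map_smul] at this
  simp [hφ, Pi.single_apply] at this
  linarith

/-- Sewell's defect bound for facet-defining inequalities of the stable set polytope
that are neither bounds nor edge inequalities. -/
theorem stmt8 {V : Type*} [Fintype V] [DecidableEq V] (G : SimpleGraph V)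
    (a : V → ℝ) (b : ℝ) (v0 : V)
    (ha : ∀ v, 0 ≤ a v) (hav0 : 0 < a v0)
    (hvalid : ∀ x ∈ Pstab G, ∑ v, a v * x v ≤ b)
    (S1 S2 : Finset V) (hS1 : IsStable G S1) (hS2 : IsStable G S2) (hne : S1 ≠ S2)
    (hv01 : v0 ∈ S1) (hv02 : v0 ∉ S2)
    (htight1 : ∑ v ∈ S1, a v = b) (htight2 : ∑ v ∈ S2, a v = b)
    (hnotedge : ∀ u v : V, G.Adj u v →
      ¬ ∃ lam : ℝ, 0 < lam ∧ (∀ w, a w = if w = u ∨ w = v then lam else 0) ∧ b = lam)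
    (hsupp : ∀ v, a v ≠ 0)
    (hfacet : Module.finrank ℝ ↥(vectorSpan ℝ {x ∈ Pstab G | ∑ v, a v * x v = b})
      = Fintype.card V - 1) :
    a v0 ≤ (∑ v, a v) - 2 * b := by
  classical
  have hst : ∀ S : Finset V, IsStable G S → ∑ v ∈ S, a v ≤ b := by
    intro S hS
    rw [← chi_sum]
    exact hvalid _ (subset_convexHull ℝ _ ⟨S, hS, rfl⟩)
  have hfp := facet_prop G a b v0 hav0 hst hfacet
  by_contra hcon
  push Not at hcon
  let N : Finset V → Finset V := fun A => Finset.univ.filter fun w => ∃ x ∈ A, G.Adj x w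
  have hN : ∀ A w, w ∈ N A ↔ ∃ x ∈ A, G.Adj x w := by intro A w; simp [N]
  let P : Finset V → Prop := fun A => IsStable G A ∧ v0 ∉ A ∧
    ∑ v ∈ (N A).erase v0, a v < ∑ v ∈ A, a v
  have hP2 : P S2 := by
    refine ⟨hS2, hv02, ?_⟩
    have h1 : ∑ v ∈ (N S2).erase v0, a v ≤ ∑ v ∈ (S2ᶜ).erase v0, a v := by
      apply Finset.sum_le_sum_of_subset_of_nonneg
      · apply Finset.erase_subset_erase
        intro w hw
        obtain ⟨x, hx, hxw⟩ := (hN _ _).1 hw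
        rw [Finset.mem_compl]
        exact fun h => hS2 x hx w h hxw
      · intro i _ _; exact ha i
    have h2 := Finset.add_sum_erase (S2ᶜ) a (Finset.mem_compl.2 hv02)
    have h3 := Finset.sum_add_sum_compl S2 a
    linarith
  obtain ⟨A, hA, hmin⟩ := exists_minimal_of_wellFoundedLT P ⟨S2, hP2⟩
  obtain ⟨hAs, hAv, hAf⟩ := hA
  -- the exchange argument
  have hkey : ∀ S, IsStable G S → ∑ v ∈ S, a v = b → (v0 ∉ S ∨ v0 ∉ N A) → A ⊆ S := by
    intro S hS hb hor
    have hB : IsStable G ((S \ N A) ∪ (A \ S)) := by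
      intro x hx y hy hxy
      simp only [Finset.mem_union, Finset.mem_sdiff] at hx hy
      rcases hx with ⟨hx, hx'⟩ | ⟨hx, hx'⟩ <;> rcases hy with ⟨hy, hy'⟩ | ⟨hy, hy'⟩
      · exact hS x hx y hy hxy
      · exact hx' ((hN _ _).2 ⟨y, hy, hxy.symm⟩)
      · exact hy' ((hN _ _).2 ⟨x, hx, hxy⟩)
      · exact hAs x hx y hy hxy
    have h1 := hst _ hB
    rw [Finset.sum_union (by
      rw [Finset.disjoint_left]; intro x hx hx'
      exact (Finset.mem_sdiff.1 hx').2 (Finset.mem_sdiff.1 hx).1)] at h1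
    have h2 := Finset.sum_inter_add_sum_sdiff S (N A) a
    have h3 := Finset.sum_inter_add_sum_sdiff A S a
    have h4 : ∑ v ∈ S ∩ N A, a v + ∑ v ∈ (N (A ∩ S)).erase v0, a v
        ≤ ∑ v ∈ (N A).erase v0, a v := by
      rw [← Finset.sum_union]
      · apply Finset.sum_le_sum_of_subset_of_nonneg
        · intro x hx
          rcases Finset.mem_union.1 hx with hx | hx
          · obtain ⟨hx1, hx2⟩ := Finset.mem_inter.1 hx
            refine Finset.mem_erase.2 ⟨?_, hx2⟩
            rintro rfl
            tauto
          · obtain ⟨hx1, hx2⟩ := Finset.mem_erase.1 hx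
            obtain ⟨y, hy, hxy⟩ := (hN _ _).1 hx2
            exact Finset.mem_erase.2 ⟨hx1, (hN _ _).2 ⟨y, (Finset.mem_inter.1 hy).1, hxy⟩⟩
        · intro i _ _; exact ha i
      · rw [Finset.disjoint_left]
        intro x hx hx'
        obtain ⟨y, hy, hxy⟩ := (hN _ _).1 (Finset.mem_erase.1 hx').2
        exact hS y (Finset.mem_inter.1 hy).2 x (Finset.mem_inter.1 hx).1 hxy
    have hPS : P (A ∩ S) := by
      refine ⟨fun x hx y hy => hAs x (Finset.mem_inter.1 hx).1 y (Finset.mem_inter.1 hy).1,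
        fun h => hAv (Finset.mem_inter.1 h).1, ?_⟩
      linarith
    have := hmin hPS Finset.inter_subset_left
    exact fun x hx => (Finset.mem_inter.1 (this hx)).2
  by_cases hv : v0 ∈ N A
  · obtain ⟨u, hu, huv⟩ := (hN _ _).1 hv
    have huv0 : u ≠ v0 := huv.ne
    have hc := hfp (fun w => (if w = u then 1 else 0) + (if w = v0 then 1 else 0)) (by
      intro S hS hb
      rw [Finset.sum_add_distrib, Finset.sum_ite_eq', Finset.sum_ite_eq']
      by_cases h : v0 ∈ S
      · have : u ∉ S := fun h' => hS u h' v0 h huv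
        simp [h, this]
      · have : u ∈ S := hkey S hS hb (Or.inl h) hu
        simp [h, this])
    have hall : ∀ w, w = u ∨ w = v0 := by
      intro w
      by_contra hw
      push Not at hw
      have := hc w u
      simp [hw.1, hw.2, huv0] at this
      exact hsupp w this
    have hauv : a u = a v0 := by
      have := hc u v0
      simpa [huv0, huv0.symm] using this
    refine hnotedge u v0 huv ⟨a v0, hav0, ?_, ?_⟩
    · intro w
      rw [if_pos (hall w)]
      rcases hall w with rfl | rfl
      · exact hauv
      · rfl
    · have : S1 = {v0} := by
        ext w
        rw [Finset.mem_singleton]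
        constructor
        · intro hw
          rcases hall w with rfl | h
          · exact absurd huv (hS1 _ hw _ hv01)
          · exact h
        · rintro rfl; exact hv01
      rw [← htight1, this, Finset.sum_singleton]
  · have hAne : A.Nonempty := by
      rw [Finset.nonempty_iff_ne_empty]
      rintro rfl
      have : (0:ℝ) ≤ ∑ v ∈ (N ∅).erase v0, a v := Finset.sum_nonneg fun i _ => ha i
      simp only [Finset.sum_empty] at hAf
      linarith
    obtain ⟨u, hu⟩ := hAne
    have huv0 : v0 ≠ u := by rintro rfl; exact hAv hu
    have hc := hfp (fun w => if w = u then 1 else 0) (by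
      intro S hS hb
      rw [Finset.sum_ite_eq', if_pos (hkey S hS hb (Or.inr hv) hu)])
    have := hc v0 u
    simp [huv0] at this
    exact hav0.ne' this
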